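/- Let (X,d,T) be a topological dynamical system with metric bounded by 1, and suppose (X,T) is uniquely ergodic. Then F(x,y) = 0 for all x,y ∈ X, where F is the weak-mean pseudometric. (It suffices to prove: if every point of X is generic for the same measure μ, then F ≡ 0.) -/

import Mathlib

open Filter Metric Set

variable {X : Type*} [MetricSpace X]

/-- The maximal cardinality of an `(n,δ)`-match of `x` and `y`: an order-preserving
bijection `π : D(π) → R(π)` between subsets of `{0,…,n-1}` such that
`d(T^i x, T^{π i} y) < δ` for all `i ∈ D(π)`, encoded by a pair of strictly
increasing enumerations of `D(π)` and `R(π)`. -/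
noncomputable def fkFit (T : X → X) (n : ℕ) (δ : ℝ) (x y : X) : ℕ :=
  sSup {k : ℕ | ∃ i j : Fin k → Fin n, StrictMono i ∧ StrictMono j ∧
    ∀ s, dist (T^[(i s : ℕ)] x) (T^[(j s : ℕ)] y) < δ}

/-- `f̄_{n,δ}(x,y) = 1 - (max match)/n`. -/
noncomputable def fkF (T : X → X) (n : ℕ) (δ : ℝ) (x y : X) : ℝ :=
  1 - (fkFit T n δ x y : ℝ) / n

/-- The Feldman–Katok metric `d_{FK_n}`. -/
noncomputable def dFKn (T : X → X) (n : ℕ) (x y : X) : ℝ :=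
  sInf {δ : ℝ | 0 < δ ∧ fkF T n δ x y < δ}

/-- The Feldman–Katok pseudometric `d_{FK}`. -/
noncomputable def dFK (T : X → X) (x y : X) : ℝ :=
  sInf {δ : ℝ | 0 < δ ∧ Filter.limsup (fun n => fkF T n δ x y) atTop < δ}

/-- The maximal cardinality of an `(n,δ)*`-match of `x` and `y`: a not necessarily
order-preserving bijection `π : D(π) → R(π)` between subsets of `{0,…,n-1}` with
`d(T^i x, T^{π i} y) < δ` on its domain, encoded by a pair of injections. -/
noncomputable def wFit (T : X → X) (n : ℕ) (δ : ℝ) (x y : X) : ℕ :=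
  sSup {k : ℕ | ∃ i j : Fin k → Fin n, Function.Injective i ∧ Function.Injective j ∧
    ∀ s, dist (T^[(i s : ℕ)] x) (T^[(j s : ℕ)] y) < δ}

/-- `f̃_{n,δ}(x,y) = 1 - (max match)/n`. -/
noncomputable def wFbar (T : X → X) (n : ℕ) (δ : ℝ) (x y : X) : ℝ :=
  1 - (wFit T n δ x y : ℝ) / n

/-- The Feldman–Katok pseudometric without the order-preserving requirement. -/
noncomputable def dFKt (T : X → X) (x y : X) : ℝ :=
  sInf {δ : ℝ | 0 < δ ∧ Filter.limsup (fun n => wFbar T n δ x y) atTop < δ}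

/-- `F_n(x,y) = (1/n) inf_{σ ∈ S_n} ∑_{k<n} d(T^k x, T^{σ k} y)`. -/
noncomputable def weakMeanN (T : X → X) (n : ℕ) (x y : X) : ℝ :=
  (1 / n : ℝ) * ⨅ σ : Equiv.Perm (Fin n),
    ∑ k : Fin n, dist (T^[(k : ℕ)] x) (T^[(σ k : ℕ)] y)

/-- The weak-mean pseudometric `F(x,y) = limsup_n F_n(x,y)`. -/
noncomputable def weakMean (T : X → X) (x y : X) : ℝ :=
  Filter.limsup (fun n => weakMeanN T n x y) Filter.atTop

open MeasureTheory

/-- The empirical measure of the first `n+1` points of the orbit of `x`. -/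
noncomputable def empMeas [MeasurableSpace X] (T : X → X) (n : ℕ) (x : X) : Measure X :=
  ((n : ENNReal) + 1)⁻¹ • ∑ k ∈ Finset.range (n + 1), Measure.dirac (T^[k] x)

instance empMeas_prob [MeasurableSpace X] (T : X → X) (n : ℕ) (x : X) :
    IsProbabilityMeasure (empMeas T n x) := by
  constructor
  simp [empMeas]
  exact ENNReal.inv_mul_cancel (by simp) (by finiteness)

/-- `empMeas` as a bundled probability measure. -/
noncomputable def empProb [MeasurableSpace X] (T : X → X) (n : ℕ) (x : X) : ProbabilityMeasure X :=
  ⟨empMeas T n x, empMeas_prob T n x⟩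

theorem integral_empMeas [MeasurableSpace X] [BorelSpace X] (T : X → X) (n : ℕ) (x : X)
    (f : BoundedContinuousFunction X ℝ) :
    ∫ a, f a ∂(empMeas T n x) = ((n : ℝ) + 1)⁻¹ * ∑ k ∈ Finset.range (n + 1), f (T^[k] x) := by
  have h1 : (((n : ENNReal) + 1)⁻¹).toReal = ((n : ℝ) + 1)⁻¹ := by
    rw [ENNReal.toReal_inv, ENNReal.toReal_add (by simp) (by simp)]; simp
  rw [empMeas, integral_smul_measure, integral_finsetSum_measure, h1]
  · simp
  · intro i _
    exact f.integrable _

theorem empMeas_real [MeasurableSpace X] (T : X → X) (n : ℕ) (x : X) (A : Set X)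
    (hA : MeasurableSet A) [DecidablePred (· ∈ A)] :
    (empMeas T n x A).toReal =
      ((Finset.univ.filter fun k : Fin (n + 1) => T^[(k : ℕ)] x ∈ A).card : ℝ) / ((n + 1 : ℕ) : ℝ) := by
  have h1 : (((n : ENNReal) + 1)⁻¹).toReal = ((n : ℝ) + 1)⁻¹ := by
    rw [ENNReal.toReal_inv, ENNReal.toReal_add (by simp) (by simp)]; simp
  have h2 : (∑ k ∈ Finset.range (n + 1), Measure.dirac (T^[k] x)) A =
      (((Finset.univ.filter fun k : Fin (n + 1) => T^[(k : ℕ)] x ∈ A).card : ℕ) : ENNReal) := by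
    rw [Measure.finsetSum_apply, ← Fin.sum_univ_eq_sum_range
      (fun k => Measure.dirac (T^[k] x) A) (n + 1), Finset.card_filter, Nat.cast_sum]
    refine Finset.sum_congr rfl fun k _ => ?_
    rw [Measure.dirac_apply' _ hA]
    by_cases h : T^[(k : ℕ)] x ∈ A <;> simp [h]
  rw [empMeas, Measure.smul_apply, smul_eq_mul, ENNReal.toReal_mul, h1, h2]
  push_cast
  rw [ENNReal.toReal_natCast]
  field_simp

theorem empMeas_tendsto [MeasurableSpace X] [BorelSpace X] [CompactSpace X] (T : X → X)
    (hT : Continuous T) (μ : ProbabilityMeasure X)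
    (hu : ∀ ν : Measure X, IsProbabilityMeasure ν ∧ MeasurePreserving T ν ν → ν = μ) (x : X) :
    Tendsto (fun n => empProb T n x) atTop
      (nhds μ) := by
  set e : ℕ → ProbabilityMeasure X := fun n => empProb T n x with he
  rw [tendsto_iff_ultrafilter]
  intro U hU
  obtain ⟨ν, -, hν⟩ := isCompact_univ.ultrafilter_le_nhds (U.map e) (by simp)
  have hν' : Tendsto e U (nhds ν) := hν
  have key : (ν : Measure X) = μ := by
    apply hu
    refine ⟨inferInstance, hT.measurable, ?_⟩
    haveI : IsProbabilityMeasure (Measure.map T (ν : Measure X)) :=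
      Measure.isProbabilityMeasure_map hT.measurable.aemeasurable
    refine ext_of_forall_integral_eq_of_IsFiniteMeasure fun f => ?_
    rw [integral_map hT.measurable.aemeasurable f.continuous.aestronglyMeasurable]
    have a1 := (ProbabilityMeasure.tendsto_iff_forall_integral_tendsto.1 hν') f
    have a2 := (ProbabilityMeasure.tendsto_iff_forall_integral_tendsto.1 hν')
      (f.compContinuous ⟨T, hT⟩)
    have a3 := a2.sub a1
    have a4 : Tendsto (fun n => (∫ a, (f.compContinuous ⟨T, hT⟩) a ∂(e n : Measure X)) -
        ∫ a, f a ∂(e n : Measure X)) atTop (nhds 0) := by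
      have b0 : Tendsto (fun n : ℕ => (2 * ‖f‖) * (1 / ((n : ℝ) + 1))) atTop (nhds 0) := by
        simpa using tendsto_one_div_add_atTop_nhds_zero_nat.const_mul (2 * ‖f‖)
      refine squeeze_zero_norm (fun n => ?_) b0
      have b1 : (e n : Measure X) = empMeas T n x := rfl
      rw [b1, integral_empMeas, integral_empMeas, ← mul_sub, ← Finset.sum_sub_distrib]
      have b2 : ∑ k ∈ Finset.range (n + 1),
          ((f.compContinuous ⟨T, hT⟩) (T^[k] x) - f (T^[k] x)) = f (T^[n+1] x) - f x := by
        have := Finset.sum_range_sub (fun k => f (T^[k] x)) (n + 1)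
        simpa [Function.iterate_succ_apply'] using this
      rw [b2, norm_mul, mul_comm, one_div]
      have b3 : ‖f (T^[n+1] x) - f x‖ ≤ 2 * ‖f‖ := by
        have := norm_sub_le (f (T^[n+1] x)) (f x)
        linarith [f.norm_coe_le_norm (T^[n+1] x), f.norm_coe_le_norm x]
      have b4 : ‖((n : ℝ) + 1)⁻¹‖ = ((n : ℝ) + 1)⁻¹ := by
        rw [Real.norm_of_nonneg]; positivity
      rw [b4]
      gcongr
    have a5 := tendsto_nhds_unique a3 (a4.mono_left hU)
    exact sub_eq_zero.1 a5
  have : ν = μ := Subtype.ext key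
  exact this ▸ hν'

/-- Matching lemma. -/
theorem exists_perm_mismatch {C : Type*} [DecidableEq C] (n : ℕ) (a b : Fin n → C)
    (S : Finset C) (hS : ∀ k, a k ∈ S) :
    ∃ σ : Equiv.Perm (Fin n), ((Finset.univ.filter fun k => a k ≠ b (σ k)).card : ℝ) ≤
      ∑ j ∈ S, |((Finset.univ.filter fun k => a k = j).card : ℝ) -
        ((Finset.univ.filter fun k => b k = j).card : ℝ)| := by
  obtain ⟨σ, hσ⟩ := Finite.exists_min
    (fun σ : Equiv.Perm (Fin n) => (Finset.univ.filter fun k => a k ≠ b (σ k)).card)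
  refine ⟨σ, ?_⟩
  rw [Finset.card_eq_sum_card_fiberwise (f := a) (t := S) (fun k _ => hS k)]
  push_cast
  refine Finset.sum_le_sum fun j _ => ?_
  rw [Finset.filter_filter]
  rcases Finset.eq_empty_or_nonempty (Finset.univ.filter fun k => a k ≠ b (σ k) ∧ a k = j) with h | h
  · rw [h]; simp
  obtain ⟨k, hk⟩ := h
  simp only [Finset.mem_filter, Finset.mem_univ, true_and] at hk
  have claim : ∀ l, b (σ l) = j → a l = j := by
    intro l hl
    by_contra hne
    have hkl : k ≠ l := fun h => hne (h ▸ hk.2)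
    refine absurd (hσ (Equiv.swap k l |>.trans σ)) (not_le.2 ?_)
    apply Finset.card_lt_card
    rw [Finset.ssubset_iff_of_subset]
    · refine ⟨k, by simp [hk.1], ?_⟩
      intro hm
      have hm' := (Finset.mem_filter.1 hm).2
      rw [Equiv.trans_apply, Equiv.swap_apply_left] at hm'
      exact hm' (hk.2.trans hl.symm)
    · intro m hm
      replace hm := (Finset.mem_filter.1 hm).2
      rw [Equiv.trans_apply] at hm
      refine Finset.mem_filter.2 ⟨Finset.mem_univ _, ?_⟩
      by_cases h1 : m = k
      · subst h1; exact hk.1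
      by_cases h2 : m = l
      · subst h2; rw [hl]; exact hne
      rwa [Equiv.swap_apply_of_ne_of_ne h1 h2] at hm
  have c1 : (Finset.univ.filter fun k => b k = j).card =
      (Finset.univ.filter fun k => a k = j ∧ a k = b (σ k)).card := by
    symm
    apply Finset.card_bij (fun k _ => σ k)
    · intro m hm
      simp only [Finset.mem_filter, Finset.mem_univ, true_and] at hm ⊢
      rw [← hm.2, hm.1]
    · intro _ _ _ _ h
      exact σ.injective h
    · intro m hm
      simp only [Finset.mem_filter, Finset.mem_univ, true_and] at hm
      refine ⟨σ.symm m, ?_, by simp⟩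
      have := claim (σ.symm m) (by simpa using hm)
      simp [this, hm]
  have c2 := Finset.card_filter_add_card_filter_not (s := Finset.univ.filter fun k => a k = j)
    (fun k => a k = b (σ k))
  rw [Finset.filter_filter, Finset.filter_filter] at c2
  have c3 : (Finset.univ.filter fun k => a k ≠ b (σ k) ∧ a k = j) =
      Finset.univ.filter fun k => a k = j ∧ ¬ a k = b (σ k) := by
    ext m; simp [and_comm]
  rw [c3, c1, ← c2]
  push_cast
  rw [add_sub_cancel_left]
  exact le_abs_self _

theorem weakMeanN_nonneg (T : X → X) (n : ℕ) (x y : X) : 0 ≤ weakMeanN T n x y := by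
  unfold weakMeanN
  refine mul_nonneg (by positivity) (Real.iInf_nonneg fun σ => Finset.sum_nonneg fun _ _ => dist_nonneg)

theorem weakMeanN_le {C : Type*} [DecidableEq C] (T : X → X) (hd : ∀ a b : X, dist a b ≤ 1)
    (n : ℕ) (x y : X) (ε : ℝ) (c : X → C) (hc : ∀ a b, c a = c b → dist a b ≤ ε)
    (S : Finset C) (hS : ∀ a, c a ∈ S) (hε : 0 ≤ ε) :
    weakMeanN T (n + 1) x y ≤ ε +
      ∑ j ∈ S, |((Finset.univ.filter fun k : Fin (n + 1) => c (T^[(k : ℕ)] x) = j).card : ℝ) / ((n + 1 : ℕ) : ℝ) -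
        ((Finset.univ.filter fun k : Fin (n + 1) => c (T^[(k : ℕ)] y) = j).card : ℝ) / ((n + 1 : ℕ) : ℝ)| := by
  obtain ⟨σ, hσ⟩ := exists_perm_mismatch (n + 1) (fun k : Fin (n + 1) => c (T^[(k : ℕ)] x))
    (fun k : Fin (n + 1) => c (T^[(k : ℕ)] y)) S (fun k => hS _)
  have hn : (0 : ℝ) < ((n + 1 : ℕ) : ℝ) := by positivity
  have h1 : (⨅ σ : Equiv.Perm (Fin (n + 1)),
      ∑ k : Fin (n + 1), dist (T^[(k : ℕ)] x) (T^[(σ k : ℕ)] y)) ≤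
      ∑ k : Fin (n + 1), dist (T^[(k : ℕ)] x) (T^[(σ k : ℕ)] y) :=
    ciInf_le (Set.finite_range _).bddBelow σ
  have h2 : ∑ k : Fin (n + 1), dist (T^[(k : ℕ)] x) (T^[(σ k : ℕ)] y) ≤
      ∑ k : Fin (n + 1), (ε + if c (T^[(k : ℕ)] x) ≠ c (T^[(σ k : ℕ)] y) then 1 else 0) := by
    refine Finset.sum_le_sum fun k _ => ?_
    split_ifs with h
    · linarith [hd (T^[(k : ℕ)] x) (T^[(σ k : ℕ)] y)]
    · push Not at h
      linarith [hc _ _ h]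
  rw [Finset.sum_add_distrib, ← Finset.sum_filter, Finset.sum_const, Finset.sum_const] at h2
  simp only [Finset.card_univ, Fintype.card_fin, nsmul_eq_mul, mul_one] at h2
  simp_rw [← sub_div, abs_div, abs_of_pos hn]
  rw [← Finset.sum_div, weakMeanN, one_div, inv_mul_le_iff₀ hn, mul_add, mul_div_cancel₀ _ hn.ne']
  linarith

theorem frontier_biInter_null [MeasurableSpace X] (μ : Measure X) (t : Finset X) (B : X → Set X)
    (h : ∀ i ∈ t, μ (frontier (B i)) = 0) : μ (frontier (⋂ i ∈ t, B i)) = 0 := by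
  classical
  induction t using Finset.induction_on with
  | empty => simp
  | insert a s ha ih =>
    rw [Finset.set_biInter_insert]
    exact null_frontier_inter (h a (by simp)) (ih fun i hi => h i (by simp [hi]))

/-- If `(X,T)` is a uniquely ergodic topological dynamical system whose metric is
bounded by `1`, then the weak-mean pseudometric vanishes identically:
`F(x,y) = 0` for all `x, y`. -/
theorem weakMean_eq_zero_of_uniquelyErgodic [MeasurableSpace X] [BorelSpace X]
    [CompactSpace X] (T : X → X) (hT : Continuous T)
    (hd : ∀ a b : X, dist a b ≤ 1)
    (hue : ∃! μ : Measure X, IsProbabilityMeasure μ ∧ MeasurePreserving T μ μ) :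
    ∀ x y : X, weakMean T x y = 0 := by
  classical
  intro x y
  obtain ⟨μ, ⟨hμ, -⟩, hu⟩ := hue
  let P : ProbabilityMeasure X := ⟨μ, hμ⟩
  have tx := empMeas_tendsto T hT P hu x
  have ty := empMeas_tendsto T hT P hu y
  suffices h : Tendsto (fun n => weakMeanN T n x y) atTop (nhds 0) from h.limsup_eq
  rw [← tendsto_add_atTop_iff_nat 1]
  rw [Metric.tendsto_atTop]
  intro ε hε
  have hr : ∀ z : X, ∃ r ∈ Set.Ioo 0 (ε / 4), μ (frontier (Metric.thickening r {z})) = 0 :=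
    fun z => exists_null_frontier_thickening μ {z} (by positivity)
  choose r hr hr0 using hr
  simp only [Metric.thickening_singleton] at hr0
  obtain ⟨t, ht⟩ := isCompact_univ.elim_finite_subcover (fun z => Metric.ball z (r z))
    (fun z => Metric.isOpen_ball) (fun z _ => Set.mem_iUnion.2 ⟨z, Metric.mem_ball_self (hr z).1⟩)
  set c : X → Finset X := fun a => t.filter fun z => a ∈ Metric.ball z (r z) with hcdef
  have hc : ∀ a b, c a = c b → dist a b ≤ ε / 2 := by
    intro a b hab
    obtain ⟨z, hz, haz⟩ := Set.mem_iUnion₂.1 (ht (Set.mem_univ a))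
    have h1 : z ∈ c a := Finset.mem_filter.2 ⟨hz, haz⟩
    rw [hab] at h1
    have h2 := (Finset.mem_filter.1 h1).2
    have := dist_triangle_right a b z
    rw [Metric.mem_ball] at haz h2
    linarith [(hr z).2]
  have hset : ∀ j ∈ t.powerset, {a | c a = j} =
      ⋂ z ∈ t, (if z ∈ j then Metric.ball z (r z) else (Metric.ball z (r z))ᶜ) := by
    intro j hj
    rw [Finset.mem_powerset] at hj
    ext a
    simp only [Set.mem_ofPred_eq, Set.mem_iInter, hcdef, Finset.ext_iff, Finset.mem_filter]
    constructor
    · intro h z hz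
      have := h z
      split_ifs with h'
      · exact (this.2 h').2
      · exact fun h2 => h' (this.1 ⟨hz, h2⟩)
    · intro h z
      constructor
      · rintro ⟨hz, h2⟩
        by_contra h'
        have := h z hz
        rw [if_neg h'] at this
        exact this h2
      · intro h'
        have := h z (hj h')
        rw [if_pos h'] at this
        exact ⟨hj h', this⟩
  have hmeas : ∀ j ∈ t.powerset, MeasurableSet {a | c a = j} := by
    intro j hj
    rw [hset j hj]
    refine Finset.measurableSet_biInter _ fun z _ => ?_
    split_ifs
    · exact measurableSet_ball
    · exact measurableSet_ball.compl
  have hfr : ∀ j ∈ t.powerset, μ (frontier {a | c a = j}) = 0 := by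
    intro j hj
    rw [hset j hj]
    refine frontier_biInter_null _ _ _ fun z _ => ?_
    split_ifs
    · exact hr0 z
    · rw [frontier_compl]; exact hr0 z
  have conv : ∀ (w : X), Tendsto (fun n => empProb T n w)
      atTop (nhds P) → ∀ j ∈ t.powerset, Tendsto (fun n : ℕ =>
      ((Finset.univ.filter fun k : Fin (n + 1) => c (T^[(k : ℕ)] w) = j).card : ℝ) / ((n + 1 : ℕ) : ℝ))
      atTop (nhds (μ {a | c a = j}).toReal) := by
    intro w hw j hj
    have h1 := ProbabilityMeasure.tendsto_measure_of_null_frontier_of_tendsto' hw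
      (E := {a | c a = j}) (hfr j hj)
    have h2 := (ENNReal.tendsto_toReal (measure_ne_top μ {a | c a = j})).comp h1
    refine h2.congr fun n => ?_
    exact empMeas_real T n w {a | c a = j} (hmeas j hj)
  have lim : Tendsto (fun n : ℕ => ∑ j ∈ t.powerset,
      |((Finset.univ.filter fun k : Fin (n + 1) => c (T^[(k : ℕ)] x) = j).card : ℝ) / ((n + 1 : ℕ) : ℝ) -
        ((Finset.univ.filter fun k : Fin (n + 1) => c (T^[(k : ℕ)] y) = j).card : ℝ) / ((n + 1 : ℕ) : ℝ)|)
      atTop (nhds 0) := by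
    have := tendsto_finsetSum t.powerset fun j hj => ((conv x tx j hj).sub (conv y ty j hj)).abs
    simpa only [sub_self, abs_zero, Finset.sum_const_zero] using this
  obtain ⟨N, hN⟩ := eventually_atTop.1 (lim.eventually_lt_const (half_pos hε))
  refine ⟨N, fun n hn => ?_⟩
  rw [Real.dist_eq, sub_zero, abs_of_nonneg (weakMeanN_nonneg _ _ _ _)]
  have h1 := weakMeanN_le T hd n x y (ε / 2) c hc t.powerset
    (fun a => Finset.mem_powerset.2 (Finset.filter_subset _ _)) (by positivity)
  have h2 := hN n hn
  linarith
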